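/- arXiv:1405.1250 — 11 statements merged into one kernel-verified Lean document; each statement's English description precedes it below -/
import Mathlib

section
/- Let a, b, c, d be the cell counts of a 2×2 contingency table with n = a+b+c+d, J = min(b,c), and let p_i = C(a+b, a+i)·C(c+d, d+i) / C(n, a+c) for 0 ≤ i ≤ J, p_F = Σ_{i=0}^J p_i, and q_1 = p_1/p_0. If the dependency is positive, i.e. the lift γ = n·a/((a+b)·(a+c)) satisfies γ > 1, then p_F ≤ p_0 · (1 − q_1^{J+1})/(1 − q_1). -/
/-- Theorem 1, first upper bound: for a positive dependency (lift γ > 1),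
Fisher's p-value `p_F = ∑_{i=0}^J p_i` is bounded by
`p_0 · (1 − q_1^{J+1})/(1 − q_1)`, where `q_1 = p_1/p_0`. -/
theorem fisher_ub2 (a b c d n J : ℕ)
    (hn : n = a + b + c + d) (hJ : J = min b c)
    (p : ℕ → ℝ)
    (hp : ∀ i, p i = ((a + b).choose (a + i) : ℝ) * ((c + d).choose (d + i) : ℝ) /
      (n.choose (a + c) : ℝ))
    (pF : ℝ) (hpF : pF = ∑ i ∈ Finset.range (J + 1), p i)
    (q1 : ℝ) (hq1 : q1 = p 1 / p 0)
    (γ : ℝ) (hγ : γ = (n : ℝ) * (a : ℝ) / (((a : ℝ) + b) * ((a : ℝ) + c)))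
    (hpos : 1 < γ) :
    pF ≤ p 0 * ((1 - q1 ^ (J + 1)) / (1 - q1)) := by
  have rec1 : ∀ i, p (i + 1) * (((a:ℝ) + i + 1) * ((d:ℝ) + i + 1)) =
      p i * (((b - i : ℕ) : ℝ) * ((c - i : ℕ) : ℝ)) := by
    intro i
    have h1 := Nat.choose_succ_right_eq (a + b) (a + i)
    have h2 := Nat.choose_succ_right_eq (c + d) (d + i)
    rw [show a + b - (a + i) = b - i by omega] at h1
    rw [show c + d - (d + i) = c - i by omega] at h2
    have h1' : ((a + b).choose (a + i + 1) : ℝ) * ((a:ℝ) + i + 1) =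
        ((a + b).choose (a + i) : ℝ) * ((b - i : ℕ) : ℝ) := by exact_mod_cast h1
    have h2' : ((c + d).choose (d + i + 1) : ℝ) * ((d:ℝ) + i + 1) =
        ((c + d).choose (d + i) : ℝ) * ((c - i : ℕ) : ℝ) := by exact_mod_cast h2
    rw [hp, hp, ← add_assoc, ← add_assoc, div_mul_eq_mul_div, div_mul_eq_mul_div]
    congr 1
    calc _ = (((a + b).choose (a + i + 1) : ℝ) * ((a:ℝ) + i + 1)) *
          (((c + d).choose (d + i + 1) : ℝ) * ((d:ℝ) + i + 1)) := by ring
      _ = _ := by rw [h1', h2']; ring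
  have hnn : ∀ i, 0 ≤ p i := by
    intro i
    rw [hp]
    positivity
  have hp0 : 0 < p 0 := by
    rw [hp]
    have h1 : 0 < (a + b).choose (a + 0) := Nat.choose_pos (by omega)
    have h2 : 0 < (c + d).choose (d + 0) := Nat.choose_pos (by omega)
    have h3 : 0 < n.choose (a + c) := Nat.choose_pos (by omega)
    positivity
  have hA : (0:ℝ) ≤ a := Nat.cast_nonneg a
  have hB : (0:ℝ) ≤ b := Nat.cast_nonneg b
  have hC : (0:ℝ) ≤ c := Nat.cast_nonneg c
  have hD : (0:ℝ) ≤ d := Nat.cast_nonneg d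
  have hq : q1 * (((a:ℝ) + 1) * ((d:ℝ) + 1)) = b * c := by
    have h := rec1 0
    simp only [Nat.cast_zero, add_zero, Nat.sub_zero, zero_add] at h
    rw [hq1, div_mul_eq_mul_div, h]
    field_simp
  have hq0 : 0 ≤ q1 := by
    rw [hq1]; exact div_nonneg (hnn 1) (hnn 0)
  have hbc : (b:ℝ) * c < a * d := by
    have hden : 0 < ((a : ℝ) + b) * ((a : ℝ) + c) := by
      rcases (by positivity : 0 ≤ ((a : ℝ) + b) * ((a : ℝ) + c)).lt_or_eq with h | h
      · exact h
      · rw [hγ, ← h, div_zero] at hpos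
        linarith
    rw [hγ, lt_div_iff₀ hden, hn] at hpos
    push_cast at hpos
    nlinarith
  have hq1lt : q1 < 1 := by
    by_contra hcon
    push Not at hcon
    have := mul_le_mul_of_nonneg_right hcon (by positivity : 0 ≤ ((a:ℝ) + 1) * ((d:ℝ) + 1))
    nlinarith
  have step : ∀ i, p (i + 1) ≤ p i * q1 := by
    intro i
    have hi : (0:ℝ) ≤ i := Nat.cast_nonneg i
    have hpos' : 0 < ((a:ℝ) + i + 1) * ((d:ℝ) + i + 1) := by positivity
    refine le_of_mul_le_mul_right ?_ hpos'
    rw [rec1, mul_assoc]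
    refine mul_le_mul_of_nonneg_left ?_ (hnn i)
    calc ((b - i : ℕ) : ℝ) * ((c - i : ℕ) : ℝ) ≤ b * c := by
          gcongr <;> omega
      _ = q1 * (((a:ℝ) + 1) * ((d:ℝ) + 1)) := hq.symm
      _ ≤ _ := by
          gcongr <;> linarith
  have bound : ∀ i, p i ≤ p 0 * q1 ^ i := by
    intro i
    induction i with
    | zero => simp
    | succ k ih =>
      calc p (k + 1) ≤ p k * q1 := step k
        _ ≤ p 0 * q1 ^ k * q1 := mul_le_mul_of_nonneg_right ih hq0
        _ = _ := by ring
  have hg : (1 - q1 ^ (J + 1)) / (1 - q1) = ∑ i ∈ Finset.range (J + 1), q1 ^ i := by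
    rw [geom_sum_eq hq1lt.ne, ← neg_div_neg_eq]
    simp
  rw [hg, hpF, Finset.mul_sum]
  exact Finset.sum_le_sum fun i _ => bound i
end

section
/- Let a, b, c, d be the cell counts of a 2×2 contingency table with n = a+b+c+d, J = min(b,c), p_0 = C(a+b, a)·C(c+d, d) / C(n, a+c), q_1 = b·c/((a+1)·(d+1)), x = (a+b)/n, pA = (a+c)/n, and lift γ = n·a/((a+b)·(a+c)). If γ > 1, then p_0 · (1 − q_1^{J+1})/(1 − q_1) ≤ p_0 · (1 + (1 − pA·γ − x·γ + x·pA·γ²)/(γ − 1)). -/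
/-- Theorem 1, second inequality: the geometric-series bound `ub2` is itself bounded
by the simple upper bound `ub1 = p_0 · (1 + (1 − pA·γ − x·γ + x·pA·γ²)/(γ − 1))`. -/
theorem fisher_ub2_le_ub1 (a b c d n J : ℕ)
    (hn : n = a + b + c + d) (hJ : J = min b c)
    (p0 : ℝ)
    (hp0 : p0 = ((a + b).choose a : ℝ) * ((c + d).choose d : ℝ) / (n.choose (a + c) : ℝ))
    (q1 : ℝ) (hq1 : q1 = (b : ℝ) * (c : ℝ) / (((a : ℝ) + 1) * ((d : ℝ) + 1)))
    (x pA : ℝ) (hx : x = ((a : ℝ) + b) / n) (hA : pA = ((a : ℝ) + c) / n)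
    (γ : ℝ) (hγ : γ = (n : ℝ) * (a : ℝ) / (((a : ℝ) + b) * ((a : ℝ) + c)))
    (hpos : 1 < γ) :
    p0 * ((1 - q1 ^ (J + 1)) / (1 - q1)) ≤
      p0 * (1 + (1 - pA * γ - x * γ + x * pA * γ ^ 2) / (γ - 1)) := by
  have ha : (0:ℝ) ≤ a := Nat.cast_nonneg a
  have hb : (0:ℝ) ≤ b := Nat.cast_nonneg b
  have hc : (0:ℝ) ≤ c := Nat.cast_nonneg c
  have hd : (0:ℝ) ≤ d := Nat.cast_nonneg d
  have hnR : (n:ℝ) = a + b + c + d := by rw [hn]; push_cast; ring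
  have ha0 : (0:ℝ) < a := by
    rcases ha.lt_or_eq with h | h
    · exact h
    · rw [← h] at hγ
      norm_num at hγ
      linarith
  have hab : (0:ℝ) < a + b := by linarith
  have hac : (0:ℝ) < a + c := by linarith
  have hn0 : (0:ℝ) < n := by linarith
  have hD : (0:ℝ) < a * d - b * c := by
    rw [hγ, one_lt_div (by positivity), hnR] at hpos
    nlinarith
  have hp0' : 0 ≤ p0 := by rw [hp0]; positivity
  have h1 : pA * γ = a / (a + b) := by
    rw [hA, hγ]; field_simp
  have h2 : x * γ = a / (a + c) := by
    rw [hx, hγ]; field_simp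
  have h3 : γ - 1 = (a * d - b * c) / ((a + b) * (a + c)) := by
    rw [hγ, hnR]; field_simp; ring
  have h4 : 1 - pA * γ - x * γ + x * pA * γ ^ 2 = b * c / ((a + b) * (a + c)) := by
    have : x * pA * γ ^ 2 = (x * γ) * (pA * γ) := by ring
    rw [this, h1, h2]; field_simp; ring
  have h5 : (1 - pA * γ - x * γ + x * pA * γ ^ 2) / (γ - 1) = b * c / (a * d - b * c) := by
    rw [h4, h3, div_div_div_cancel_right₀ (by positivity)]
  rw [h5]
  apply mul_le_mul_of_nonneg_left _ hp0'
  have hbc : (0:ℝ) ≤ b * c := by positivity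
  have hs : (0:ℝ) < (a + 1) * (d + 1) := by positivity
  have hq0 : 0 ≤ q1 := by rw [hq1]; positivity
  have hS : (0:ℝ) < (a + 1) * (d + 1) - b * c := by nlinarith
  have hq : 1 - q1 = ((a + 1) * (d + 1) - b * c) / ((a + 1) * (d + 1)) := by
    rw [hq1]; field_simp
  have hq2 : 0 < 1 - q1 := by rw [hq]; positivity
  calc (1 - q1 ^ (J + 1)) / (1 - q1) ≤ 1 / (1 - q1) := by
        apply div_le_div_of_nonneg_right _ hq2.le
        linarith [pow_nonneg hq0 (J + 1)]
    _ = 1 + b * c / ((a + 1) * (d + 1) - b * c) := by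
        rw [hq]; field_simp; ring
    _ ≤ 1 + b * c / (a * d - b * c) := by
        have := div_le_div_of_nonneg_left hbc hD
          (show (a:ℝ) * d - b * c ≤ (a + 1) * (d + 1) - b * c by nlinarith)
        linarith
end

section
/- Let a, b, c, d be the cell counts of a 2×2 contingency table with n = a+b+c+d, q_1 = b·c/((a+1)·(d+1)), x = (a+b)/n, pA = (a+c)/n, and lift γ = n·a/((a+b)·(a+c)). If γ > 1, then q_1/(1 − q_1) ≤ (1 − pA·γ − x·γ + x·pA·γ²)/(γ − 1). -/
/-- Key step of Theorem 1: `q_1/(1 − q_1) ≤ (1 − pA·γ − x·γ + x·pA·γ²)/(γ − 1)`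
when the lift satisfies `γ > 1`. -/
theorem fisher_q1_ratio_bound (a b c d n : ℕ)
    (hn : n = a + b + c + d)
    (q1 : ℝ) (hq1 : q1 = (b : ℝ) * (c : ℝ) / (((a : ℝ) + 1) * ((d : ℝ) + 1)))
    (x pA : ℝ) (hx : x = ((a : ℝ) + b) / n) (hA : pA = ((a : ℝ) + c) / n)
    (γ : ℝ) (hγ : γ = (n : ℝ) * (a : ℝ) / (((a : ℝ) + b) * ((a : ℝ) + c)))
    (hpos : 1 < γ) :
    q1 / (1 - q1) ≤ (1 - pA * γ - x * γ + x * pA * γ ^ 2) / (γ - 1) := by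
  have ha0 : a ≠ 0 := by
    rintro rfl
    rw [hγ] at hpos
    norm_num at hpos
  have ha : (0 : ℝ) < a := by exact_mod_cast Nat.pos_of_ne_zero ha0
  have hb : (0 : ℝ) ≤ b := Nat.cast_nonneg b
  have hc : (0 : ℝ) ≤ c := Nat.cast_nonneg c
  have hd : (0 : ℝ) ≤ d := Nat.cast_nonneg d
  have hnr : (n : ℝ) = a + b + c + d := by rw [hn]; push_cast; ring
  rw [hnr] at hx hA hγ
  clear hn hnr
  generalize (a : ℝ) = A at *
  generalize (b : ℝ) = B at *
  generalize (c : ℝ) = C at *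
  generalize (d : ℝ) = D at *
  have hAB : 0 < A + B := by linarith
  have hAC : 0 < A + C := by linarith
  have hN : 0 < A + B + C + D := by linarith
  have h1 : γ - 1 = (A * D - B * C) / ((A + B) * (A + C)) := by
    rw [hγ]; field_simp; ring
  have hdet : 0 < A * D - B * C := by
    have h : 0 < γ - 1 := by linarith
    rw [h1] at h
    exact (div_pos_iff_of_pos_right (mul_pos hAB hAC)).mp h
  have hp : pA * γ = A / (A + B) := by
    rw [hA, hγ]; field_simp
  have hxg : x * γ = A / (A + C) := by
    rw [hx, hγ]; field_simp
  have h2 : 1 - pA * γ - x * γ + x * pA * γ ^ 2 = B * C / ((A + B) * (A + C)) := by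
    have : 1 - pA * γ - x * γ + x * pA * γ ^ 2 = (1 - pA * γ) * (1 - x * γ) := by ring
    rw [this, hp, hxg]; field_simp; ring
  have hE : 0 < (A + 1) * (D + 1) := by positivity
  have hle : A * D - B * C ≤ (A + 1) * (D + 1) - B * C := by nlinarith
  have hpos2 : 0 < (A + 1) * (D + 1) - B * C := by linarith
  have hL : q1 / (1 - q1) = B * C / ((A + 1) * (D + 1) - B * C) := by
    have h3 : 1 - q1 = ((A + 1) * (D + 1) - B * C) / ((A + 1) * (D + 1)) := by
      rw [hq1, sub_div, div_self hE.ne']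
    rw [h3, hq1, div_div_div_cancel_right₀ hE.ne']
  rw [hL, h1, h2, div_div_div_cancel_right₀ (mul_pos hAB hAC).ne']
  exact div_le_div_of_nonneg_left (mul_nonneg hb hc) hdet hle
end

section
/- Let a, b, c, d be the cell counts of a 2×2 contingency table with n = a+b+c+d, J = min(b,c), p_i = C(a+b, a+i)·C(c+d, d+i) / C(n, a+c), p_F = Σ_{i=0}^J p_i, q_1 = p_1/p_0, and ub2 = p_0·(1 − q_1^{J+1})/(1 − q_1). If the lift γ = n·a/((a+b)·(a+c)) satisfies γ > 1, then the approximation error satisfies ub2 − p_F ≤ p_0·q_1²/(1 − q_1). -/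
/-- Theorem 2: when Fisher's `p_F` is approximated by
`ub2 = p_0·(1 − q_1^{J+1})/(1 − q_1)`, the error is bounded by
`p_0·q_1²/(1 − q_1)` (for a positive dependency, γ > 1). -/
theorem fisher_ub2_error_bound (a b c d n J : ℕ)
    (hn : n = a + b + c + d) (hJ : J = min b c)
    (p : ℕ → ℝ)
    (hp : ∀ i, p i = ((a + b).choose (a + i) : ℝ) * ((c + d).choose (d + i) : ℝ) /
      (n.choose (a + c) : ℝ))
    (pF : ℝ) (hpF : pF = ∑ i ∈ Finset.range (J + 1), p i)
    (q1 : ℝ) (hq1 : q1 = p 1 / p 0)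
    (ub2 : ℝ) (hub2 : ub2 = p 0 * ((1 - q1 ^ (J + 1)) / (1 - q1)))
    (γ : ℝ) (hγ : γ = (n : ℝ) * (a : ℝ) / (((a : ℝ) + b) * ((a : ℝ) + c)))
    (hpos : 1 < γ) :
    ub2 - pF ≤ p 0 * (q1 ^ 2 / (1 - q1)) := by
  have hnum : ((b : ℝ) * c) < a * d := by
    rw [hγ] at hpos
    have hden : 0 < (((a : ℝ) + b) * ((a : ℝ) + c)) := by
      rcases (by positivity : 0 ≤ (((a : ℝ) + b) * ((a : ℝ) + c))).eq_or_lt with h | h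
      · rw [← h, div_zero] at hpos
        linarith
      · exact h
    rw [lt_div_iff₀ hden, hn] at hpos
    push_cast at hpos
    nlinarith
  have hC : (0 : ℝ) < (n.choose (a + c) : ℝ) := by
    exact_mod_cast Nat.choose_pos (by omega)
  have hp0 : 0 < p 0 := by
    rw [hp]
    have h1 : (0 : ℝ) < ((a + b).choose (a + 0) : ℝ) := by
      exact_mod_cast Nat.choose_pos (by omega)
    have h2 : (0 : ℝ) < ((c + d).choose (d + 0) : ℝ) := by
      exact_mod_cast Nat.choose_pos (by omega)
    positivity
  have hpn : ∀ i, 0 ≤ p i := fun i => by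
    rw [hp]
    positivity
  have hr : p 1 * (((a : ℝ) + 1) * (d + 1)) = p 0 * (b * c) := by
    have e1 : ((a + b).choose (a + 1) : ℝ) * (a + 1) = ((a + b).choose a : ℝ) * b := by
      have h := Nat.choose_succ_right_eq (a + b) a
      rw [Nat.add_sub_cancel_left] at h
      exact_mod_cast h
    have e2 : ((c + d).choose (d + 1) : ℝ) * (d + 1) = ((c + d).choose d : ℝ) * c := by
      have h := Nat.choose_succ_right_eq (c + d) d
      rw [Nat.add_sub_cancel] at h
      exact_mod_cast h
    rw [hp, hp, add_zero, add_zero, div_mul_eq_mul_div, div_mul_eq_mul_div]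
    congr 1
    calc _ = (((a + b).choose (a + 1) : ℝ) * (a + 1)) * (((c + d).choose (d + 1) : ℝ) * (d + 1)) := by
          ring
      _ = _ := by
          rw [e1, e2]
          ring
  have ha : (0 : ℝ) ≤ a := Nat.cast_nonneg a
  have hd : (0 : ℝ) ≤ d := Nat.cast_nonneg d
  have hlt : p 1 < p 0 := by
    by_contra h
    push Not at h
    have h1 : p 0 * (((a : ℝ) + 1) * (d + 1)) ≤ p 1 * (((a : ℝ) + 1) * (d + 1)) :=
      mul_le_mul_of_nonneg_right h (by positivity)
    rw [hr] at h1
    have h2 := le_of_mul_le_mul_left h1 hp0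
    nlinarith
  have hq0 : 0 ≤ q1 := by
    rw [hq1]
    exact div_nonneg (hpn 1) hp0.le
  have hq : q1 < 1 := by
    rw [hq1, div_lt_one hp0]
    exact hlt
  have hp1 : p 1 = p 0 * q1 := by
    rw [hq1]
    field_simp
  have hF : p 0 + p 1 ≤ pF := by
    rw [hpF]
    rcases Nat.eq_zero_or_pos J with h0 | h0
    · have hbc : (b : ℝ) * c = 0 := by
        have : b = 0 ∨ c = 0 := by omega
        rcases this with h | h <;> simp [h]
      rw [hbc, mul_zero] at hr
      have : p 1 = 0 := by
        rcases mul_eq_zero.mp hr with h | h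
        · exact h
        · have : (0 : ℝ) < ((a : ℝ) + 1) * (d + 1) := by positivity
          linarith
      simp [h0, this]
    · have h2 : p 0 + p 1 = ∑ i ∈ Finset.range 2, p i := by
        simp [Finset.sum_range_succ]
      rw [h2]
      exact Finset.sum_le_sum_of_subset_of_nonneg
        (Finset.range_subset_range.mpr (by omega)) (fun i _ _ => hpn i)
  have hq' : 0 < 1 - q1 := by linarith
  have key : (1 - q1 ^ (J + 1)) / (1 - q1) ≤ 1 + q1 + q1 ^ 2 / (1 - q1) := by
    have e : 1 + q1 + q1 ^ 2 / (1 - q1) = 1 / (1 - q1) := by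
      field_simp
      ring
    rw [e]
    apply div_le_div_of_nonneg_right _ hq'.le
    have := pow_nonneg hq0 (J + 1)
    linarith
  have := mul_le_mul_of_nonneg_left key hp0.le
  rw [hub2]
  rw [mul_add, mul_add] at this
  linarith
end

section
/- Let a, b, c, d be the cell counts of a 2×2 contingency table with n = a+b+c+d and q_1 = b·c/((a+1)·(d+1)). If the lift γ = n·a/((a+b)·(a+c)) satisfies γ > 1, then q_1 < 1/γ. -/
/-- If the lift satisfies `γ > 1`, then `q_1 = b·c/((a+1)(d+1)) < 1/γ`. -/
theorem fisher_q1_lt_inv_lift (a b c d n : ℕ)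
    (hn : n = a + b + c + d)
    (q1 : ℝ) (hq1 : q1 = (b : ℝ) * (c : ℝ) / (((a : ℝ) + 1) * ((d : ℝ) + 1)))
    (γ : ℝ) (hγ : γ = (n : ℝ) * (a : ℝ) / (((a : ℝ) + b) * ((a : ℝ) + c)))
    (hpos : 1 < γ) :
    q1 < 1 / γ := by
  have ha : 0 < (a : ℝ) := by
    rcases Nat.eq_zero_or_pos a with h | h
    · subst h
      simp at hγ
      linarith
    · exact_mod_cast h
  subst hn hq1 hγ
  push_cast at *
  have hb : 0 ≤ (b : ℝ) := b.cast_nonneg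
  have hc : 0 ≤ (c : ℝ) := c.cast_nonneg
  have hd : 0 ≤ (d : ℝ) := d.cast_nonneg
  generalize (a : ℝ) = a at *
  generalize (b : ℝ) = b at *
  generalize (c : ℝ) = c at *
  generalize (d : ℝ) = d at *
  rw [lt_div_iff₀ (by positivity)] at hpos
  have hk : 0 < a * d - b * c := by nlinarith
  rw [one_div_div, div_lt_div_iff₀ (by positivity) (by positivity)]
  have h1 : 0 < a * (a + b + c) * (a * d - b * c) := by positivity
  have h2 : 0 ≤ (a + d + 1) * (a * (a + b + c) + b * c) := by positivity
  nlinarith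
end

section
/- Let a, b, c, d be the cell counts of a 2×2 contingency table with n = a+b+c+d, J = min(b,c), p_i = C(a+b, a+i)·C(c+d, d+i) / C(n, a+c), p_F = Σ_{i=0}^J p_i, q_1 = p_1/p_0, and ub2 = p_0·(1 − q_1^{J+1})/(1 − q_1). If the lift γ = n·a/((a+b)·(a+c)) satisfies γ ≥ (1 + √5)/2, then ub2 − p_F ≤ p_0. -/
/-- Corollary: if the lift satisfies `γ ≥ (1 + √5)/2`, then the error of the
approximation `ub2` is at most `p_0`. -/
theorem fisher_ub2_error_le_p0 (a b c d n J : ℕ)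
    (hn : n = a + b + c + d) (hJ : J = min b c)
    (p : ℕ → ℝ)
    (hp : ∀ i, p i = ((a + b).choose (a + i) : ℝ) * ((c + d).choose (d + i) : ℝ) /
      (n.choose (a + c) : ℝ))
    (pF : ℝ) (hpF : pF = ∑ i ∈ Finset.range (J + 1), p i)
    (q1 : ℝ) (hq1 : q1 = p 1 / p 0)
    (ub2 : ℝ) (hub2 : ub2 = p 0 * ((1 - q1 ^ (J + 1)) / (1 - q1)))
    (γ : ℝ) (hγ : γ = (n : ℝ) * (a : ℝ) / (((a : ℝ) + b) * ((a : ℝ) + c)))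
    (hpos : (1 + Real.sqrt 5) / 2 ≤ γ) :
    ub2 - pF ≤ p 0 := by
  have hN : (0:ℝ) < (n.choose (a + c) : ℝ) := by
    exact_mod_cast Nat.choose_pos (by omega)
  have hA : (0:ℝ) < ((a + b).choose a : ℝ) := by
    exact_mod_cast Nat.choose_pos (by omega)
  have hD : (0:ℝ) < ((c + d).choose d : ℝ) := by
    exact_mod_cast Nat.choose_pos (by omega)
  have hp0 : 0 < p 0 := by
    rw [hp 0]
    simp only [add_zero]
    positivity
  have hpn : ∀ i, 0 ≤ p i := by
    intro i
    rw [hp i]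
    positivity
  have e1 : ((a + b).choose (a + 1) : ℝ) * ((a:ℝ) + 1) = ((a + b).choose a : ℝ) * b := by
    have h := Nat.choose_succ_right_eq (a + b) a
    rw [Nat.add_sub_cancel_left] at h
    exact_mod_cast h
  have e2 : ((c + d).choose (d + 1) : ℝ) * ((d:ℝ) + 1) = ((c + d).choose d : ℝ) * c := by
    have h := Nat.choose_succ_right_eq (c + d) d
    rw [Nat.add_sub_cancel] at h
    exact_mod_cast h
  have hqp : p 1 = p 0 * q1 := by
    rw [hq1]; field_simp
  have hq0 : 0 ≤ q1 := by
    rw [hq1]; exact div_nonneg (hpn 1) (hpn 0)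
  have hq : q1 * (((a:ℝ) + 1) * ((d:ℝ) + 1)) = b * c := by
    have h : p 1 * (((a:ℝ) + 1) * ((d:ℝ) + 1)) = p 0 * (b * c) := by
      rw [hp 0, hp 1]
      simp only [add_zero]
      rw [div_mul_eq_mul_div, div_mul_eq_mul_div]
      congr 1
      linear_combination ((c + d).choose (d + 1) : ℝ) * ((d:ℝ) + 1) * e1
        + ((a + b).choose a : ℝ) * b * e2
    rw [hqp, mul_assoc] at h
    exact mul_left_cancel₀ hp0.ne' h
  obtain ⟨f, hf⟩ : ∃ f : ℝ, f = (1 + Real.sqrt 5) / 2 := ⟨_, rfl⟩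
  rw [← hf] at hpos
  have hs : Real.sqrt 5 ^ 2 = 5 := Real.sq_sqrt (by norm_num)
  have hs0 : 0 ≤ Real.sqrt 5 := Real.sqrt_nonneg 5
  have hf2 : f ^ 2 = f + 1 := by rw [hf]; linear_combination hs / 4
  have hf1 : 1 < f := by
    rw [hf]; nlinarith
  have ha : (0:ℝ) ≤ a := Nat.cast_nonneg a
  have hb : (0:ℝ) ≤ b := Nat.cast_nonneg b
  have hc : (0:ℝ) ≤ c := Nat.cast_nonneg c
  have hd : (0:ℝ) ≤ d := Nat.cast_nonneg d
  have hden : 0 < ((a : ℝ) + b) * ((a : ℝ) + c) := by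
    rcases (by positivity : 0 ≤ ((a : ℝ) + b) * ((a : ℝ) + c)).lt_or_eq with h | h
    · exact h
    · rw [← h, div_zero] at hγ
      linarith
  rw [hγ, le_div_iff₀ hden, hn] at hpos
  push_cast at hpos
  have hS : 0 ≤ (f - 1) * ((a:ℝ) * (a + b + c)) :=
    mul_nonneg (by linarith) (by positivity)
  have hbc : f * (b * c : ℝ) ≤ a * d := by linarith
  have hqf : q1 * f ≤ 1 := by
    have hM : 0 < ((a:ℝ) + 1) * ((d:ℝ) + 1) := by positivity
    refine le_of_mul_le_mul_right ?_ hM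
    have h1 : q1 * f * (((a:ℝ) + 1) * ((d:ℝ) + 1)) = f * (b * c) := by
      rw [← hq]; ring
    rw [h1]
    linarith
  have hq1f : q1 ≤ f - 1 := by
    refine le_of_mul_le_mul_right ?_ (by linarith : 0 < f)
    linarith
  have hqq : q1 * q1 + q1 ≤ 1 := by linarith [mul_le_mul_of_nonneg_left hq1f hq0]
  have hlt : 0 < 1 - q1 := by
    by_contra h
    have := mul_nonneg hq0 (by linarith : 0 ≤ q1 - 1)
    linarith
  have hF : p 0 + p 1 ≤ pF := by
    rw [hpF]
    rcases Nat.eq_zero_or_pos J with h | h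
    · have h0 : (b * c : ℝ) = 0 := by
        rcases (by omega : b = 0 ∨ c = 0) with h | h <;> simp [h]
      have : q1 = 0 := by
        rw [h0] at hq
        rcases mul_eq_zero.mp hq with h | h
        · exact h
        · exact absurd h (by positivity)
      simp [h, hqp, this]
    · have : ∑ i ∈ Finset.range 2, p i ≤ ∑ i ∈ Finset.range (J + 1), p i :=
        Finset.sum_le_sum_of_subset_of_nonneg
          (Finset.range_subset_range.mpr (by omega)) (fun i _ _ => hpn i)
      simpa [Finset.sum_range_succ] using this
  have hU : (1 - q1 ^ (J + 1)) / (1 - q1) ≤ 2 + q1 := by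
    rw [div_le_iff₀ hlt]
    have := pow_nonneg hq0 (J + 1)
    linarith
  have := mul_le_mul_of_nonneg_left hU hp0.le
  rw [hub2]
  linarith
end

section
/- Let a, b, c, d be the cell counts of a 2×2 contingency table with n = a+b+c+d, J = min(b,c), p_i = C(a+b, a+i)·C(c+d, d+i) / C(n, a+c), p_F = Σ_{i=0}^J p_i, q_1 = p_1/p_0, and ub2 = p_0·(1 − q_1^{J+1})/(1 − q_1). If the lift γ = n·a/((a+b)·(a+c)) satisfies γ ≥ (1 + √5)/2, then ub2 ≤ 2·p_F. -/
/-- If the lift satisfies `γ ≥ (1 + √5)/2`, then `ub2 ≤ 2·p_F`. -/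
theorem fisher_ub2_le_two_pF (a b c d n J : ℕ)
    (hn : n = a + b + c + d) (hJ : J = min b c)
    (p : ℕ → ℝ)
    (hp : ∀ i, p i = ((a + b).choose (a + i) : ℝ) * ((c + d).choose (d + i) : ℝ) /
      (n.choose (a + c) : ℝ))
    (pF : ℝ) (hpF : pF = ∑ i ∈ Finset.range (J + 1), p i)
    (q1 : ℝ) (hq1 : q1 = p 1 / p 0)
    (ub2 : ℝ) (hub2 : ub2 = p 0 * ((1 - q1 ^ (J + 1)) / (1 - q1)))
    (γ : ℝ) (hγ : γ = (n : ℝ) * (a : ℝ) / (((a : ℝ) + b) * ((a : ℝ) + c)))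
    (hpos : (1 + Real.sqrt 5) / 2 ≤ γ) :
    ub2 ≤ 2 * pF := by
  have hs : (2 : ℝ) ≤ Real.sqrt 5 := Real.le_sqrt_of_sq_le (by norm_num)
  have h32 : (3 : ℝ) / 2 ≤ γ := by linarith
  have hA : (0 : ℝ) ≤ a := Nat.cast_nonneg a
  have hB : (0 : ℝ) ≤ b := Nat.cast_nonneg b
  have hC : (0 : ℝ) ≤ c := Nat.cast_nonneg c
  have hD : (0 : ℝ) ≤ d := Nat.cast_nonneg d
  have hbc : 3 * ((b : ℝ) * c) ≤ 2 * ((a : ℝ) * d) := by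
    have hden : (0 : ℝ) < ((a : ℝ) + b) * ((a : ℝ) + c) := by
      rcases (by positivity : (0 : ℝ) ≤ ((a : ℝ) + b) * ((a : ℝ) + c)).eq_or_lt with h | h
      · rw [hγ, ← h] at h32
        norm_num at h32
      · exact h
    rw [hγ, le_div_iff₀ hden, hn] at h32
    push_cast at h32
    nlinarith [mul_nonneg hA hA, mul_nonneg hA hB, mul_nonneg hA hC]
  have hnc : (0 : ℝ) < (n.choose (a + c) : ℝ) := by
    exact_mod_cast Nat.choose_pos (by omega)
  have hnn : ∀ i, 0 ≤ p i := fun i => by rw [hp]; positivity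
  have hp0 : 0 < p 0 := by
    rw [hp]
    have h1 : (0 : ℝ) < ((a + b).choose (a + 0) : ℝ) := by
      exact_mod_cast Nat.choose_pos (by omega)
    have h2 : (0 : ℝ) < ((c + d).choose (d + 0) : ℝ) := by
      exact_mod_cast Nat.choose_pos (by omega)
    positivity
  have hrec : p 1 * (((a : ℝ) + 1) * (d + 1)) = p 0 * (b * c) := by
    have h1 := Nat.choose_succ_right_eq (a + b) a
    have h2 := Nat.choose_succ_right_eq (c + d) d
    rw [show a + b - a = b by omega] at h1
    rw [show c + d - d = c by omega] at h2
    have h1' : ((a + b).choose (a + 1) : ℝ) * (a + 1) = (a + b).choose a * b := by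
      exact_mod_cast h1
    have h2' : ((c + d).choose (d + 1) : ℝ) * (d + 1) = (c + d).choose d * c := by
      exact_mod_cast h2
    rw [hp, hp, div_mul_eq_mul_div, div_mul_eq_mul_div]
    congr 1
    simp only [add_zero]
    linear_combination ((c + d).choose (d + 1) : ℝ) * (d + 1) * h1' +
      ((a + b).choose a : ℝ) * b * h2'
  have hp1 : p 1 = p 0 * q1 := by rw [hq1]; field_simp
  have hq0 : 0 ≤ q1 := by rw [hq1]; exact div_nonneg (hnn 1) hp0.le
  have hq23 : q1 ≤ 2 / 3 := by
    have e : q1 * (((a : ℝ) + 1) * (d + 1)) = b * c := by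
      rw [hp1, mul_assoc] at hrec
      exact mul_left_cancel₀ hp0.ne' hrec
    have hpos2 : (0 : ℝ) < ((a : ℝ) + 1) * (d + 1) := by positivity
    refine le_of_mul_le_mul_right ?_ hpos2
    rw [e]
    nlinarith
  have h1q : 0 < 1 - q1 := by linarith
  rcases Nat.eq_zero_or_pos J with h0 | hJ1
  · subst h0
    rw [hub2, hpF]
    simp only [zero_add, pow_one, Finset.sum_range_one, div_self h1q.ne']
    linarith
  · have hF : p 0 + p 1 ≤ pF := by
      rw [hpF]
      have := Finset.sum_le_sum_of_subset_of_nonneg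
        (Finset.range_subset_range.2 (show 2 ≤ J + 1 by omega)) (f := p) (fun i _ _ => hnn i)
      simpa [Finset.sum_range_succ] using this
    have hk : (1 - q1 ^ (J + 1)) / (1 - q1) ≤ 2 * (1 + q1) := by
      rw [div_le_iff₀ h1q]
      have := pow_nonneg hq0 (J + 1)
      nlinarith
    rw [hub2]
    have := mul_le_mul_of_nonneg_left hk hp0.le
    rw [hp1] at hF
    linarith
end

section
/- Let a, b, c, d be the cell counts of a 2×2 contingency table with n = a+b+c+d, x = (a+b)/n, pA = (a+c)/n, lift γ = n·a/((a+b)·(a+c)), p_0 = C(a+b, a)·C(c+d, d)/C(n, a+c), and ub1 = p_0·(1 + (1 − pA·γ − x·γ + x·pA·γ²)/(γ − 1)). If γ ≥ 2, then ub1 ≤ 2·p_0·(1 − pA − x + 2·x·pA). -/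
/-- When `γ ≥ 2`, the simple upper bound satisfies
`ub1 ≤ 2·p_0·(1 − pA − x + 2·x·pA)`. -/
theorem fisher_ub1_bound_gamma_ge_two (a b c d n : ℕ)
    (hn : n = a + b + c + d)
    (x pA : ℝ) (hx : x = ((a : ℝ) + b) / n) (hA : pA = ((a : ℝ) + c) / n)
    (γ : ℝ) (hγ : γ = (n : ℝ) * (a : ℝ) / (((a : ℝ) + b) * ((a : ℝ) + c)))
    (p0 : ℝ)
    (hp0 : p0 = ((a + b).choose a : ℝ) * ((c + d).choose d : ℝ) / (n.choose (a + c) : ℝ))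
    (ub1 : ℝ)
    (hub1 : ub1 = p0 * (1 + (1 - pA * γ - x * γ + x * pA * γ ^ 2) / (γ - 1)))
    (hpos : 2 ≤ γ) :
    ub1 ≤ 2 * p0 * (1 - pA - x + 2 * x * pA) := by
  have hp0' : 0 ≤ p0 := by rw [hp0]; positivity
  have hγ0 : γ ≠ 0 := by linarith
  have ha0 : (0:ℝ) ≤ a := Nat.cast_nonneg a
  have hb0 : (0:ℝ) ≤ b := Nat.cast_nonneg b
  have hc0 : (0:ℝ) ≤ c := Nat.cast_nonneg c
  have ha : (a:ℝ) ≠ 0 := by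
    intro h
    apply hγ0
    rw [hγ, h]; simp
  have hapos : (0:ℝ) < a := lt_of_le_of_ne ha0 (Ne.symm ha)
  have hnn : (n:ℝ) ≠ 0 := by
    intro h
    apply hγ0
    rw [hγ, h]; simp
  have hab : (0:ℝ) < a + b := by linarith
  have hac : (0:ℝ) < a + c := by linarith
  have hpγ : pA * γ = a / (a + b) := by
    rw [hA, hγ]; field_simp
  have hxγ : x * γ = a / (a + c) := by
    rw [hx, hγ]; field_simp
  have h1 : pA * γ ≤ 1 := by
    rw [hpγ, div_le_one hab]; linarith
  have h2 : x * γ ≤ 1 := by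
    rw [hxγ, div_le_one hac]; linarith
  have hp : 0 ≤ pA := by rw [hA]; positivity
  have hx0 : 0 ≤ x := by rw [hx]; positivity
  clear hpγ hxγ hx hA hγ hp0
  have hu : 0 ≤ 1 - 2 * pA := by nlinarith
  have hv : 0 ≤ 1 - 2 * x := by nlinarith
  have key : (1 - pA * γ - x * γ + x * pA * γ ^ 2) / (γ - 1)
      ≤ (1 - 2 * pA) * (1 - 2 * x) := by
    rw [div_le_iff₀ (by linarith)]
    have e : 0 ≤ (γ - 2) * ((1 - 2 * pA) * (1 - 2 * x) + pA * (1 - 2 * x)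
        + x * (1 - pA * γ)) := by
      apply mul_nonneg (by linarith)
      have := mul_nonneg hu hv
      have := mul_nonneg hp hv
      have := mul_nonneg hx0 (sub_nonneg.2 h1)
      linarith
    nlinarith [e]
  rw [hub1]
  have := mul_le_mul_of_nonneg_left key hp0'
  nlinarith [this]
end

section
/- Let a, b, c, d be the cell counts of a 2×2 contingency table with n = a+b+c+d, J = min(b,c), p_i = C(a+b, a+i)·C(c+d, d+i) / C(n, a+c), p_F = Σ_{i=0}^J p_i, x = (a+b)/n, pA = (a+c)/n, lift γ = n·a/((a+b)·(a+c)), and ub1 = p_0·(1 + (1 − pA·γ − x·γ + x·pA·γ²)/(γ − 1)). If γ ≥ 2, then the approximation error satisfies ub1 − p_F ≤ p_0. -/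
/-- Theorem 3: if `p_F` is approximated with the simple upper bound `ub1` and the
lift satisfies `γ ≥ 2`, the error is bounded by `ub1 − p_F ≤ p_0`. -/
theorem fisher_ub1_error_le_p0 (a b c d n J : ℕ)
    (hn : n = a + b + c + d) (hJ : J = min b c)
    (p : ℕ → ℝ)
    (hp : ∀ i, p i = ((a + b).choose (a + i) : ℝ) * ((c + d).choose (d + i) : ℝ) /
      (n.choose (a + c) : ℝ))
    (pF : ℝ) (hpF : pF = ∑ i ∈ Finset.range (J + 1), p i)
    (x pA : ℝ) (hx : x = ((a : ℝ) + b) / n) (hA : pA = ((a : ℝ) + c) / n)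
    (γ : ℝ) (hγ : γ = (n : ℝ) * (a : ℝ) / (((a : ℝ) + b) * ((a : ℝ) + c)))
    (ub1 : ℝ)
    (hub1 : ub1 = p 0 * (1 + (1 - pA * γ - x * γ + x * pA * γ ^ 2) / (γ - 1)))
    (hpos : 2 ≤ γ) :
    ub1 - pF ≤ p 0 := by
  have hpn : ∀ i, 0 ≤ p i := fun i => by rw [hp]; positivity
  have h0 : p 0 ≤ pF := by
    rw [hpF]
    exact Finset.single_le_sum (f := p) (fun i _ => hpn i) (Finset.mem_range.mpr (Nat.succ_pos J))
  have ha : 0 < (a : ℝ) := by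
    rcases Nat.eq_zero_or_pos a with h | h
    · subst h
      simp at hγ
      linarith
    · exact_mod_cast h
  have hn0 : 0 < (n : ℝ) := by
    have : 0 < a := by exact_mod_cast ha
    have : 0 < n := by omega
    exact_mod_cast this
  have hb : (0 : ℝ) ≤ b := Nat.cast_nonneg b
  have hc : (0 : ℝ) ≤ c := Nat.cast_nonneg c
  have hu : pA * γ = a / ((a : ℝ) + b) := by
    rw [hA, hγ]; field_simp
  have hv : x * γ = a / ((a : ℝ) + c) := by
    rw [hx, hγ]; field_simp
  have hu0 : 0 ≤ pA * γ := by rw [hu]; positivity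
  have hv0 : 0 ≤ x * γ := by rw [hv]; positivity
  have hv1 : x * γ ≤ 1 := by rw [hv, div_le_one (by positivity)]; linarith
  have hE : (1 - pA * γ - x * γ + x * pA * γ ^ 2) / (γ - 1) ≤ 1 := by
    rw [div_le_one (by linarith)]
    nlinarith [mul_nonneg hu0 (sub_nonneg.mpr hv1)]
  have := mul_le_mul_of_nonneg_left hE (hpn 0)
  rw [hub1]
  linarith
end

section
/- Let a, b, c, d be the cell counts of a 2×2 contingency table with n = a+b+c+d, J = min(b,c), p_i = C(a+b, a+i)·C(c+d, d+i) / C(n, a+c), and p_F = Σ_{i=0}^J p_i. Suppose the lift γ = n·a/((a+b)·(a+c)) satisfies γ > 1, and let l be an integer with 0 ≤ l and l + 1 ≤ J. With q_{l+1} = (b − l)·(c − l)/((a + l + 1)·(d + l + 1)), one has p_F ≤ p_0 + p_1 + … + p_{l−1} + p_l·(1 − q_{l+1}^{J−l+1})/(1 − q_{l+1}). -/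
/-- Theorem 4 (general upper bound): for a positive dependency (γ > 1) and any
`l` with `l + 1 ≤ J`,
`p_F ≤ p_0 + … + p_{l−1} + p_l·(1 − q_{l+1}^{J−l+1})/(1 − q_{l+1})`,
where `q_{l+1} = (b−l)(c−l)/((a+l+1)(d+l+1))`. -/
theorem fisher_general_ub (a b c d n J l : ℕ)
    (hn : n = a + b + c + d) (hJ : J = min b c)
    (p : ℕ → ℝ)
    (hp : ∀ i, p i = ((a + b).choose (a + i) : ℝ) * ((c + d).choose (d + i) : ℝ) /
      (n.choose (a + c) : ℝ))
    (pF : ℝ) (hpF : pF = ∑ i ∈ Finset.range (J + 1), p i)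
    (γ : ℝ) (hγ : γ = (n : ℝ) * (a : ℝ) / (((a : ℝ) + b) * ((a : ℝ) + c)))
    (hpos : 1 < γ)
    (hl : l + 1 ≤ J)
    (q : ℝ)
    (hq : q = ((b : ℝ) - l) * ((c : ℝ) - l) / (((a : ℝ) + l + 1) * ((d : ℝ) + l + 1))) :
    pF ≤ (∑ i ∈ Finset.range l, p i) + p l * ((1 - q ^ (J - l + 1)) / (1 - q)) := by
  have had : (b : ℝ) * c < a * d := by
    have hD : 0 < ((a : ℝ) + b) * ((a : ℝ) + c) := by
      rcases (show 0 ≤ ((a : ℝ) + b) * ((a : ℝ) + c) by positivity).lt_or_eq with h | h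
      · exact h
      · rw [hγ, ← h] at hpos
        norm_num at hpos
    rw [hγ, lt_div_iff₀ hD, hn] at hpos
    push_cast at hpos
    nlinarith
  have hlb : l + 1 ≤ b := by omega
  have hlc : l + 1 ≤ c := by omega
  have hlb' : (l : ℝ) + 1 ≤ b := by exact_mod_cast hlb
  have hlc' : (l : ℝ) + 1 ≤ c := by exact_mod_cast hlc
  have ha0 : (0 : ℝ) ≤ a := by positivity
  have hd0 : (0 : ℝ) ≤ d := by positivity
  have hl0 : (0 : ℝ) ≤ l := by positivity
  have hB : 0 < ((a : ℝ) + l + 1) * ((d : ℝ) + l + 1) := by positivity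
  have hq0 : 0 ≤ q := by
    rw [hq]
    exact div_nonneg (mul_nonneg (by linarith) (by linarith)) hB.le
  have hq1 : q < 1 := by
    rw [hq, div_lt_one hB]
    have h1 : ((b : ℝ) - l) * ((c : ℝ) - l) ≤ b * c :=
      mul_le_mul (by linarith) (by linarith) (by linarith) (by linarith)
    have h2 : (a : ℝ) * d ≤ ((a : ℝ) + l + 1) * ((d : ℝ) + l + 1) :=
      mul_le_mul (by linarith) (by linarith) (by linarith) (by linarith)
    linarith
  have hp0 : ∀ i, 0 ≤ p i := fun i => by rw [hp]; positivity
  have hrec : ∀ i, i ≤ J → p (i + 1) * (((a : ℝ) + i + 1) * ((d : ℝ) + i + 1)) =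
      p i * (((b : ℝ) - i) * ((c : ℝ) - i)) := by
    intro i hi
    have e1 := Nat.choose_succ_right_eq (a + b) (a + i)
    have e2 := Nat.choose_succ_right_eq (c + d) (d + i)
    rw [show a + b - (a + i) = b - i by omega] at e1
    rw [show c + d - (d + i) = c - i by omega] at e2
    have f1 : ((a + b).choose (a + (i + 1)) : ℝ) * ((a : ℝ) + i + 1) =
        ((a + b).choose (a + i) : ℝ) * ((b : ℝ) - i) := by
      rw [← Nat.cast_sub (show i ≤ b by omega)]
      exact_mod_cast e1
    have f2 : ((c + d).choose (d + (i + 1)) : ℝ) * ((d : ℝ) + i + 1) =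
        ((c + d).choose (d + i) : ℝ) * ((c : ℝ) - i) := by
      rw [← Nat.cast_sub (show i ≤ c by omega)]
      exact_mod_cast e2
    rw [hp, hp, div_mul_eq_mul_div, div_mul_eq_mul_div, mul_mul_mul_comm, f1, f2,
      mul_mul_mul_comm]
  have hkey : ∀ k, l + k ≤ J → p (l + k) ≤ p l * q ^ k := by
    intro k
    induction k with
    | zero => intro _; simp
    | succ k ih =>
      intro hk
      have ih' := ih (by omega)
      have hr := hrec (l + k) (by omega)
      have hb1 : ((l + k : ℕ) : ℝ) + 1 ≤ b := by exact_mod_cast (show l + k + 1 ≤ b by omega)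
      have hc1 : ((l + k : ℕ) : ℝ) + 1 ≤ c := by exact_mod_cast (show l + k + 1 ≤ c by omega)
      have hlk : (l : ℝ) ≤ ((l + k : ℕ) : ℝ) := by exact_mod_cast (show l ≤ l + k by omega)
      generalize ((l + k : ℕ) : ℝ) = x at *
      have hX : 0 < ((a : ℝ) + x + 1) * ((d : ℝ) + x + 1) :=
        mul_pos (by linarith) (by linarith)
      have h1 : ((b : ℝ) - x) * ((c : ℝ) - x) ≤ ((b : ℝ) - l) * ((c : ℝ) - l) :=
        mul_le_mul (by linarith) (by linarith) (by linarith) (by linarith)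
      have h2 : ((a : ℝ) + l + 1) * ((d : ℝ) + l + 1) ≤ ((a : ℝ) + x + 1) * ((d : ℝ) + x + 1) :=
        mul_le_mul (by linarith) (by linarith) (by linarith) (by linarith)
      have h3 : ((b : ℝ) - x) * ((c : ℝ) - x) ≤ q * (((a : ℝ) + x + 1) * ((d : ℝ) + x + 1)) := by
        have : q * (((a : ℝ) + l + 1) * ((d : ℝ) + l + 1)) = ((b : ℝ) - l) * ((c : ℝ) - l) := by
          rw [hq, div_mul_cancel₀ _ hB.ne']
        have := mul_le_mul_of_nonneg_left h2 hq0
        linarith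
      have h4 : p (l + k + 1) ≤ p (l + k) * q := by
        refine le_of_mul_le_mul_right ?_ hX
        rw [hr, mul_assoc]
        exact mul_le_mul_of_nonneg_left h3 (hp0 _)
      calc p (l + (k + 1)) ≤ p (l + k) * q := h4
        _ ≤ p l * q ^ k * q := mul_le_mul_of_nonneg_right ih' hq0
        _ = p l * q ^ (k + 1) := by ring
  have hg : (1 - q ^ (J - l + 1)) / (1 - q) = ∑ k ∈ Finset.range (J - l + 1), q ^ k := by
    rw [geom_sum_eq hq1.ne, ← neg_div_neg_eq, neg_sub, neg_sub]
  rw [hpF, hg, show J + 1 = l + (J - l + 1) by omega, Finset.sum_range_add, Finset.mul_sum]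
  refine add_le_add le_rfl (Finset.sum_le_sum fun k hk => ?_)
  exact hkey k (by have := Finset.mem_range.mp hk; omega)
end

section
/- Let a, b, c, d be the cell counts of a 2×2 contingency table with n = a+b+c+d, J = min(b,c), p_i = C(a+b, a+i)·C(c+d, d+i) / C(n, a+c), and p_F = Σ_{i=0}^J p_i. Suppose the lift γ = n·a/((a+b)·(a+c)) satisfies γ > 1, and let l be an integer with 0 ≤ l and l + 1 ≤ J. With q_{l+1} = (b − l)·(c − l)/((a + l + 1)·(d + l + 1)), the error of the general approximation satisfies (p_0 + … + p_{l−1} + p_l·(1 − q_{l+1}^{J−l+1})/(1 − q_{l+1})) − p_F ≤ p_0·q_{l+1}²/(1 − q_{l+1}). -/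
/-- Theorem 4 (error of the general upper bound): for a positive dependency
(γ > 1) and any `l` with `l + 1 ≤ J`, the error of the approximation
`p_0 + … + p_{l−1} + p_l·(1 − q_{l+1}^{J−l+1})/(1 − q_{l+1})`
is bounded by `p_0·q_{l+1}²/(1 − q_{l+1})`. -/
theorem fisher_general_ub_error (a b c d n J l : ℕ)
    (hn : n = a + b + c + d) (hJ : J = min b c)
    (p : ℕ → ℝ)
    (hp : ∀ i, p i = ((a + b).choose (a + i) : ℝ) * ((c + d).choose (d + i) : ℝ) /
      (n.choose (a + c) : ℝ))
    (pF : ℝ) (hpF : pF = ∑ i ∈ Finset.range (J + 1), p i)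
    (γ : ℝ) (hγ : γ = (n : ℝ) * (a : ℝ) / (((a : ℝ) + b) * ((a : ℝ) + c)))
    (hpos : 1 < γ)
    (hl : l + 1 ≤ J)
    (q : ℝ)
    (hq : q = ((b : ℝ) - l) * ((c : ℝ) - l) / (((a : ℝ) + l + 1) * ((d : ℝ) + l + 1))) :
    ((∑ i ∈ Finset.range l, p i) + p l * ((1 - q ^ (J - l + 1)) / (1 - q))) - pF ≤
      p 0 * (q ^ 2 / (1 - q)) := by
  have hbc : J ≤ b ∧ J ≤ c := by omega
  have hbcad : (b : ℝ) * c < a * d := by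
    have hD : (0 : ℝ) ≤ ((a : ℝ) + b) * ((a : ℝ) + c) := by positivity
    rcases hD.eq_or_lt with h | h
    · rw [hγ, ← h, div_zero] at hpos
      linarith
    · rw [hγ, lt_div_iff₀ h, hn] at hpos
      push_cast at hpos
      nlinarith
  have hp0 : ∀ i, 0 ≤ p i := fun i => by rw [hp]; positivity
  have hrec : ∀ i, i ≤ J → p (i + 1) =
      p i * (((b : ℝ) - i) * ((c : ℝ) - i) / (((a : ℝ) + i + 1) * ((d : ℝ) + i + 1))) := by
    intro i hi
    have h1 := Nat.choose_succ_right_eq (a + b) (a + i)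
    have h2 := Nat.choose_succ_right_eq (c + d) (d + i)
    rw [show a + b - (a + i) = b - i by omega] at h1
    rw [show c + d - (d + i) = c - i by omega] at h2
    have h1' := congrArg (Nat.cast : ℕ → ℝ) h1
    have h2' := congrArg (Nat.cast : ℕ → ℝ) h2
    push_cast [Nat.cast_sub (show i ≤ b by omega)] at h1'
    push_cast [Nat.cast_sub (show i ≤ c by omega)] at h2'
    have hA : (0 : ℝ) < (a : ℝ) + i + 1 := by positivity
    have hB : (0 : ℝ) < (d : ℝ) + i + 1 := by positivity
    rw [← mul_div_assoc, eq_div_iff (by positivity), hp, hp, ← add_assoc, ← add_assoc,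
      div_mul_eq_mul_div, div_mul_eq_mul_div]
    congr 1
    linear_combination (((c + d).choose (d + i + 1) : ℝ) * ((d : ℝ) + i + 1)) * h1' +
      (((a + b).choose (a + i) : ℝ) * ((b : ℝ) - i)) * h2'
  have hqb : ∀ i : ℕ, i ≤ J →
      0 ≤ ((b : ℝ) - i) * ((c : ℝ) - i) / (((a : ℝ) + i + 1) * ((d : ℝ) + i + 1)) ∧
      ((b : ℝ) - i) * ((c : ℝ) - i) / (((a : ℝ) + i + 1) * ((d : ℝ) + i + 1)) < 1 := by
    intro i hi
    have hb : (i : ℝ) ≤ b := by exact_mod_cast hi.trans hbc.1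
    have hc : (i : ℝ) ≤ c := by exact_mod_cast hi.trans hbc.2
    have hi0 : (0 : ℝ) ≤ i := by positivity
    have ha0 : (0 : ℝ) ≤ a := by positivity
    have hd0 : (0 : ℝ) ≤ d := by positivity
    constructor
    · exact div_nonneg (mul_nonneg (by linarith) (by linarith)) (by positivity)
    · rw [div_lt_one (by positivity)]
      have e1 : ((b : ℝ) - i) * ((c : ℝ) - i) ≤ b * c :=
        mul_le_mul (by linarith) (by linarith) (by linarith) (by linarith)
      have e2 : (a : ℝ) * d ≤ ((a : ℝ) + i + 1) * ((d : ℝ) + i + 1) :=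
        mul_le_mul (by linarith) (by linarith) (by linarith) (by linarith)
      linarith
  have hle : ∀ i, i ≤ J → p i ≤ p 0 := by
    intro i
    induction i with
    | zero => intro _; exact le_rfl
    | succ k ih =>
      intro hk
      have h := hqb k (by omega)
      rw [hrec k (by omega)]
      exact (mul_le_of_le_one_right (hp0 k) h.2.le).trans (ih (by omega))
  have hq' := hqb l (by omega)
  have hr := hrec l (by omega)
  rw [← hq] at hq' hr
  obtain ⟨hq0, hq1⟩ := hq'
  have hs : (∑ i ∈ Finset.range (l + 2), p i) ≤ pF := by
    rw [hpF]
    apply Finset.sum_le_sum_of_subset_of_nonneg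
    · intro x hx
      simp only [Finset.mem_range] at *
      omega
    · intro i _ _
      exact hp0 i
  rw [Finset.sum_range_succ, Finset.sum_range_succ, hr] at hs
  have h1q : 0 < 1 - q := by linarith
  have key : (1 - q ^ (J - l + 1)) / (1 - q) ≤ 1 + q + q ^ 2 / (1 - q) := by
    have : 1 + q + q ^ 2 / (1 - q) = 1 / (1 - q) := by field_simp; ring
    rw [this]
    have := pow_nonneg hq0 (J - l + 1)
    gcongr
    linarith
  have k1 := mul_le_mul_of_nonneg_left key (hp0 l)
  have k2 := mul_le_mul_of_nonneg_right (hle l (by omega))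
    (show 0 ≤ q ^ 2 / (1 - q) by positivity)
  linarith
end
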